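/- There is an absolute constant C > 0 with the following property: if R > 0 and u is a classical solution of the one-phase free boundary problem in the open disk B_R ⊆ ℝ² with 0 ∈ F(u), then |∇u(z)| ≤ C for every z ∈ B_{R/2} ∩ Ω⁺(u); equivalently, u is Lipschitz on B_{R/2} with Lipschitz constant C. -/

import Mathlib

open Complex Metric Set Filter MeasureTheory
open scoped Topology Classical NNReal

noncomputable section

/-- The positive phase of `u` in `Ω`. -/
def posSet (Ω : Set ℂ) (u : ℂ → ℝ) : Set ℂ := {z ∈ Ω | 0 < u z}

/-- The free boundary of `u` in `Ω`. -/
def FB (Ω : Set ℂ) (u : ℂ → ℝ) : Set ℂ := Ω ∩ frontier (posSet Ω u)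

/-- The gradient of `u : ℂ → ℝ`, viewed as a complex number `∂ₓu + i ∂ᵧu`. -/
def grad2 (u : ℂ → ℝ) (z : ℂ) : ℂ :=
  ((fderiv ℝ u z 1 : ℝ) : ℂ) + ((fderiv ℝ u z Complex.I : ℝ) : ℂ) * Complex.I

/-- Second derivative (Hessian) of `u : ℂ → ℝ` at `z` in directions `v, w`. -/
def hess (u : ℂ → ℝ) (z v w : ℂ) : ℝ := fderiv ℝ (fun x => fderiv ℝ u x v) z w

/-- `u` is harmonic on `s`: twice continuously differentiable with vanishing Laplacian. -/
def HarmonicOn2 (u : ℂ → ℝ) (s : Set ℂ) : Prop :=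
  ContDiffOn ℝ 2 u s ∧ ∀ z ∈ s, hess u z 1 1 + hess u z Complex.I Complex.I = 0

/-- A classical solution of the one-phase free boundary problem `Δu = 0` in `{u>0}`,
`|∇u| = 1` on the free boundary, in the open set `Ω ⊆ ℝ² ≅ ℂ`. -/
structure IsClassicalSolution (Ω : Set ℂ) (u : ℂ → ℝ) : Prop where
  contOn : ContinuousOn u Ω
  nonneg : ∀ z ∈ Ω, 0 ≤ u z
  harm : HarmonicOn2 u (posSet Ω u)
  smooth_ext : ∃ v : ℂ → ℝ, ContDiffOn ℝ (⊤ : ℕ∞) v (Ω ∩ closure (posSet Ω u)) ∧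
    Set.EqOn u v (Ω ∩ closure (posSet Ω u))
  fb_manifold : ∀ z ∈ FB Ω u, ∃ V : Set ℂ, IsOpen V ∧ z ∈ V ∧ V ⊆ Ω ∧
    ∃ φ : ℂ → ℝ, ContDiffOn ℝ (⊤ : ℕ∞) φ V ∧ (∀ w ∈ V, fderiv ℝ φ w ≠ 0) ∧
      V ∩ posSet Ω u = {w ∈ V | 0 < φ w} ∧
      V ∩ {w | u w = 0} = {w ∈ V | φ w ≤ 0} ∧
      V ∩ FB Ω u = {w ∈ V | φ w = 0}
  grad_one : ∀ z ∈ FB Ω u,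
    Filter.Tendsto (fun w => ‖grad2 u w‖) (nhdsWithin z (posSet Ω u)) (nhds 1)

/-- One-plane solution `P(z) = max (Re z) 0`. -/
def Pfun (z : ℂ) : ℝ := max z.re 0

/-- Wedge solution `W_s(z) = s |Re z|`. -/
def Wfun (s : ℝ) (z : ℂ) : ℝ := s * |z.re|

/-- Two-plane solution `TP_a`. -/
def TPfun (a : ℝ) (z : ℂ) : ℝ := max z.re 0 + max (-z.re - a) 0

/-- Rotation of the plane by angle `θ`. -/
def rot (θ : ℝ) (z : ℂ) : ℂ := Complex.exp (θ * Complex.I) * z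

/-- The strip `S = {|Im ζ| < π/2}`. -/
def Sstrip : Set ℂ := {ζ : ℂ | |ζ.im| < Real.pi / 2}

/-- The hairpin domain `Ω₁ = {|x₂| < π/2 + cosh x₁}`. -/
def Omega1 : Set ℂ := {z : ℂ | |z.im| < Real.pi / 2 + Real.cosh z.re}

/-- Dilated hairpin domain `Ω_a = aΩ₁`. -/
def OmegaA (a : ℝ) : Set ℂ := {z : ℂ | z / (a : ℂ) ∈ Omega1}

/-- The Hauswirth–Hélein–Pacard double hairpin solution `H = H₁`:
`H(z) = Re (cosh w)` where `w` is the unique point of the strip `S` with `w + sinh w = z`,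
and `H(z) = 0` if there is no such point. -/
def hairpinH (z : ℂ) : ℝ :=
  if h : ∃ w : ℂ, w ∈ Sstrip ∧ w + Complex.sinh w = z then (Complex.cosh h.choose).re else 0

/-- The double hairpin solution `H_a(z) = a H(z/a)`. -/
def hairpin (a : ℝ) (z : ℂ) : ℝ := a * hairpinH (z / (a : ℂ))

/-- Euclidean dot product of two complex numbers viewed as vectors in ℝ². -/
def dot2 (a b : ℂ) : ℝ := a.re * b.re + a.im * b.im

/-- Divergence of a vector field `ψ : ℂ → ℂ` on ℝ². -/
def div2 (ψ : ℂ → ℂ) (z : ℂ) : ℝ := (fderiv ℝ ψ z 1).re + (fderiv ℝ ψ z Complex.I).im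

/-- A variational (weak) solution of the one-phase free boundary problem in `Ω`:
`u ∈ H¹_loc(Ω) ∩ C(Ω)`, `u ≥ 0`, `u ∈ C²({u>0})`, and the domain-variation
Euler–Lagrange identity holds for all compactly supported smooth vector fields. -/
def VariationalSolution (Ω : Set ℂ) (u : ℂ → ℝ) : Prop :=
  ContinuousOn u Ω ∧ (∀ z ∈ Ω, 0 ≤ u z) ∧
  (∀ K : Set ℂ, K ⊆ Ω → IsCompact K →
    MeasureTheory.IntegrableOn (fun z => (u z) ^ 2 + ‖grad2 u z‖ ^ 2) K) ∧
  ContDiffOn ℝ 2 u (posSet Ω u) ∧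
  ∀ ψ : ℂ → ℂ, ContDiff ℝ (⊤ : ℕ∞) ψ → HasCompactSupport ψ → tsupport ψ ⊆ Ω →
    ∫ z in Ω, ((‖grad2 u z‖ ^ 2 + Set.indicator {w | 0 < u w} (fun _ => (1 : ℝ)) z) * div2 ψ z
      - 2 * dot2 (grad2 u z) (fderiv ℝ ψ z (grad2 u z))) = 0

/-- Average of `w` over the circle of radius `r` around `z`. -/
def circleAvg (w : ℂ → ℝ) (z : ℂ) (r : ℝ) : ℝ :=
  (1 / (2 * Real.pi)) * ∫ θ in (0 : ℝ)..(2 * Real.pi), w (z + r * Complex.exp (θ * Complex.I))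

/-- Superharmonicity on `s` via the super-mean-value property. -/
def SuperharmonicOn2 (w : ℂ → ℝ) (s : Set ℂ) : Prop :=
  ∀ z ∈ s, ∀ r : ℝ, 0 < r → Metric.closedBall z r ⊆ s → circleAvg w z r ≤ w z

/-- Subharmonicity on `s` via the sub-mean-value property. -/
def SubharmonicOn2 (w : ℂ → ℝ) (s : Set ℂ) : Prop :=
  ∀ z ∈ s, ∀ r : ℝ, 0 < r → Metric.closedBall z r ⊆ s → w z ≤ circleAvg w z r

/-- Non-tangential approach region in `B` at `x₀` with aperture `C`. -/
def NontangentialIn (B : Set ℂ) (x₀ : ℂ) (C : ℝ) : Set ℂ :=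
  {x ∈ B | ‖x - x₀‖ ≤ C * Metric.infDist x Bᶜ}

/-- `w(x) = α ⟨x − x₀, ν⟩⁺ + o(|x − x₀|)` as `x → x₀` within the region `R`. -/
def HasSlopeAt (w : ℂ → ℝ) (x₀ ν : ℂ) (α : ℝ) (R : Set ℂ) : Prop :=
  Filter.Tendsto (fun x => (w x - α * max (dot2 (x - x₀) ν) 0) / ‖x - x₀‖)
    (nhdsWithin x₀ R) (nhds 0)

/-- Viscosity supersolution of the one-phase free boundary problem in `Ω`. -/
structure ViscositySupersolution (Ω : Set ℂ) (w : ℂ → ℝ) : Prop where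
  contOn : ContinuousOn w Ω
  nonneg : ∀ z ∈ Ω, 0 ≤ w z
  superharm : SuperharmonicOn2 w (posSet Ω w)
  slope : ∀ x₀ ∈ FB Ω w, ∀ (y : ℂ) (ρ : ℝ), 0 < ρ → Metric.ball y ρ ⊆ posSet Ω w →
    dist x₀ y = ρ → ∃ α : ℝ, α ≤ 1 ∧ ∀ C : ℝ, 1 < C →
      HasSlopeAt w x₀ ((y - x₀) / (ρ : ℂ)) α (NontangentialIn (Metric.ball y ρ) x₀ C)

/-- Viscosity subsolution of the one-phase free boundary problem in `Ω`. -/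
structure ViscositySubsolution (Ω : Set ℂ) (w : ℂ → ℝ) : Prop where
  contOn : ContinuousOn w Ω
  nonneg : ∀ z ∈ Ω, 0 ≤ w z
  subharm : SubharmonicOn2 w (posSet Ω w)
  slope : ∀ x₀ ∈ FB Ω w, ∀ (y : ℂ) (ρ : ℝ), 0 < ρ →
    Metric.ball y ρ ⊆ {z ∈ Ω | w z = 0} → dist x₀ y = ρ →
    ∃ α : ℝ, 1 ≤ α ∧ ∀ C : ℝ, 1 < C →
      HasSlopeAt w x₀ ((x₀ - y) / (ρ : ℂ)) α
        (NontangentialIn (closure (Metric.ball y ρ))ᶜ x₀ C)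

/-- Viscosity solution: both a supersolution and a subsolution. -/
def ViscositySolution (Ω : Set ℂ) (w : ℂ → ℝ) : Prop :=
  ViscositySupersolution Ω w ∧ ViscositySubsolution Ω w

/-- Non-degeneracy with constant `c`: linear growth away from the free boundary. -/
def Nondegenerate (Ω : Set ℂ) (w : ℂ → ℝ) (c : ℝ) : Prop :=
  ∀ x ∈ FB Ω w, ∀ r : ℝ, 0 < r → Metric.ball x r ⊆ Ω → c * r ≤ sSup (w '' Metric.ball x r)

/-- The open annulus `{δ < |z| < R}`. -/
def ann (δ R : ℝ) : Set ℂ := {z : ℂ | δ < ‖z‖ ∧ ‖z‖ < R}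

/-- Condition (A): the free boundary of `u` in the annulus `{δ < |z| < R}` consists of
exactly two connected components, each non-compact with closure meeting both boundary
circles. -/
def ConditionA (δ R : ℝ) (u : ℂ → ℝ) : Prop :=
  ∃ F₁ F₂ : Set ℂ,
    F₁.Nonempty ∧ F₂.Nonempty ∧ Disjoint F₁ F₂ ∧
    F₁ ∪ F₂ = FB (ann δ R) u ∧
    (∀ z ∈ F₁, connectedComponentIn (FB (ann δ R) u) z = F₁) ∧
    (∀ z ∈ F₂, connectedComponentIn (FB (ann δ R) u) z = F₂) ∧
    ¬ IsCompact F₁ ∧ ¬ IsCompact F₂ ∧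
    (closure F₁ ∩ Metric.sphere 0 δ).Nonempty ∧
    (closure F₁ ∩ Metric.sphere 0 R).Nonempty ∧
    (closure F₂ ∩ Metric.sphere 0 δ).Nonempty ∧
    (closure F₂ ∩ Metric.sphere 0 R).Nonempty

/-- `k` is the curvature of the set `S` at the point `p`, computed via an arc-length
parametrization. -/
def IsCurvatureAt (S : Set ℂ) (p : ℂ) (k : ℝ) : Prop :=
  ∃ γ : ℝ → ℂ, ContDiff ℝ 2 γ ∧ γ 0 = p ∧ (∀ s : ℝ, ‖deriv γ s‖ = 1) ∧
    (∃ ε > 0, ∀ s ∈ Set.Ioo (-ε) ε, γ s ∈ S) ∧ ‖deriv (deriv γ) 0‖ = k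

/-- A set has exactly two connected components. -/
def HasExactlyTwoComponents (S : Set ℂ) : Prop :=
  ∃ z₁ ∈ S, ∃ z₂ ∈ S, connectedComponentIn S z₁ ≠ connectedComponentIn S z₂ ∧
    ∀ z ∈ S, connectedComponentIn S z = connectedComponentIn S z₁ ∨
      connectedComponentIn S z = connectedComponentIn S z₂

end

lemma aux_harnack {F : ℂ → ℂ} {z : ℂ} {d : ℝ} (hd : 0 < d)
    (hF : DifferentiableOn ℂ F (ball z d)) (hpos : ∀ w ∈ ball z d, 0 < (F w).re) :
    (∀ w ∈ ball z d, (F z).re * (1 - dist w z / d) ≤ (F w).re * (1 + dist w z / d)) ∧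
    ‖deriv F z‖ ≤ 2 * (F z).re / d := by
  have hz : z ∈ ball z d := mem_ball_self hd
  have hA := hpos z hz
  have key : ∀ w ∈ ball z d, (F w + (starRingEnd ℂ) (F z)) ≠ 0 := by
    intro w hw h
    have := congrArg Complex.re h
    simp at this
    linarith [hpos w hw]
  set g : ℂ → ℂ := fun w => (F w - F z) / (F w + (starRingEnd ℂ) (F z)) with hg
  have hgz : g z = 0 := by simp [hg]
  have hgd : DifferentiableOn ℂ g (ball z d) :=
    (hF.sub_const _).div (hF.add_const _) key
  have hmaps : MapsTo g (ball z d) (closedBall (g z) 1) := by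
    intro w hw
    rw [hgz, mem_closedBall_zero_iff, hg]
    simp only [norm_div]
    rw [div_le_one (norm_pos_iff.2 (key w hw))]
    have h1 := hpos w hw
    rw [← sq_le_sq₀ (norm_nonneg _) (norm_nonneg _), ← Complex.normSq_eq_norm_sq,
      ← Complex.normSq_eq_norm_sq, Complex.normSq_apply, Complex.normSq_apply]
    simp
    nlinarith [mul_pos h1 hA]
  constructor
  · intro w hw
    have h := Complex.dist_le_div_mul_dist_of_mapsTo_ball hgd hmaps hw
    rw [hgz, dist_zero_right] at h
    have hk : 1 / d * dist w z = dist w z / d := by ring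
    rw [hk] at h
    have hk1 : dist w z / d < 1 := by rw [div_lt_one hd]; exact hw
    have hk0 : 0 ≤ dist w z / d := by positivity
    set k := dist w z / d
    simp only [hg, norm_div] at h
    rw [div_le_iff₀ (norm_pos_iff.2 (key w hw))] at h
    have h1 := hpos w hw
    rw [← sq_le_sq₀ (norm_nonneg _) (by positivity), mul_pow, ← Complex.normSq_eq_norm_sq,
      ← Complex.normSq_eq_norm_sq, Complex.normSq_apply, Complex.normSq_apply] at h
    simp at h
    have h2 : ((F z).re - (F w).re) ^ 2 ≤ (k * ((F w).re + (F z).re)) ^ 2 := by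
      have : k ^ 2 ≤ 1 := by nlinarith
      nlinarith [mul_nonneg (sub_nonneg.2 this) (sq_nonneg ((F w).im - (F z).im))]
    have h3 := abs_le_of_sq_le_sq h2 (by positivity)
    have := (abs_le.1 (abs_le_of_sq_le_sq h2 (by positivity))).2
    linarith
  · have h := Complex.norm_deriv_le_div_of_mapsTo_ball hgd hmaps hd
    have hFd : HasDerivAt F (deriv F z) z :=
      (hF.differentiableAt (isOpen_ball.mem_nhds hz)).hasDerivAt
    have hgd' := (hFd.sub_const (F z)).div (hFd.add_const ((starRingEnd ℂ) (F z))) (key z hz)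
    have e : deriv g z = deriv F z / (2 * (F z).re : ℝ) := by
      refine hgd'.deriv.trans ?_
      have hk := key z hz
      have : F z + (starRingEnd ℂ) (F z) = ((2 * (F z).re : ℝ) : ℂ) := Complex.add_conj _
      rw [this] at hk ⊢
      field_simp
      ring
    rw [e, norm_div, Complex.norm_real, Real.norm_eq_abs, abs_of_pos (by positivity),
      div_le_iff₀ (by positivity)] at h
    calc _ ≤ _ := h
      _ = _ := by ring

lemma aux_fderiv_norm (u : ℂ → ℝ) (z : ℂ) : ‖fderiv ℝ u z‖ ≤ ‖grad2 u z‖ := by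
  refine ContinuousLinearMap.opNorm_le_bound _ (norm_nonneg _) fun v => ?_
  have hv : fderiv ℝ u z v = v.re * fderiv ℝ u z 1 + v.im * fderiv ℝ u z I := by
    conv_lhs => rw [← Complex.re_add_im v]
    have h1 : (v.re : ℂ) + v.im * I = v.re • (1 : ℂ) + v.im • I := by simp
    rw [h1, map_add, map_smul, map_smul]; simp
  rw [← sq_le_sq₀ (norm_nonneg _) (by positivity), mul_pow, ← Complex.normSq_eq_norm_sq,
    ← Complex.normSq_eq_norm_sq, Complex.normSq_apply, Complex.normSq_apply, hv,
    Real.norm_eq_abs, sq_abs]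
  simp [grad2]
  nlinarith [sq_nonneg (v.re * fderiv ℝ u z I - v.im * fderiv ℝ u z 1)]

lemma aux_harm {u : ℂ → ℝ} {s : Set ℂ} (hs : IsOpen s) (h : HarmonicOn2 u s) :
    InnerProductSpace.HarmonicOnNhd u s := by
  intro x hx
  refine ⟨h.1.contDiffAt (hs.mem_nhds hx), ?_⟩
  filter_upwards [hs.mem_nhds hx] with y hy
  have hc := h.1.contDiffAt (hs.mem_nhds hy)
  have hd : DifferentiableAt ℝ (fderiv ℝ u) y :=
    (hc.fderiv_right (m := 1) (by norm_num)).differentiableAt (by norm_num)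
  have e : ∀ v w : ℂ, hess u y v w = fderiv ℝ (fderiv ℝ u) y w v := by
    intro v w
    unfold hess
    rw [fderiv_clm_apply hd (by fun_prop)]
    simp
  rw [InnerProductSpace.laplacian_eq_iteratedFDeriv_complexPlane]
  simp only [iteratedFDeriv_two_apply]
  have := h.2 y hy
  rw [e, e] at this
  simpa using this

/-- Harnack and gradient estimate for positive harmonic functions in a disk. -/
lemma aux_pos {u : ℂ → ℝ} {s : Set ℂ} (hs : IsOpen s) (h : HarmonicOn2 u s) {z : ℂ} {d : ℝ}
    (hd : 0 < d) (hsub : ball z d ⊆ s) (hpos : ∀ w ∈ s, 0 < u w) :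
    (∀ w ∈ ball z d, u z * (1 - dist w z / d) ≤ u w * (1 + dist w z / d)) ∧
    ‖grad2 u z‖ ≤ 2 * u z / d := by
  obtain ⟨F, hF, hFu⟩ := InnerProductSpace.HarmonicOnNhd.exists_analyticOnNhd_ball_re_eq
    (fun x hx => aux_harm hs h x (hsub hx) : InnerProductSpace.HarmonicOnNhd u (ball z d))
  have hz : z ∈ ball z d := mem_ball_self hd
  have hFu' : ∀ w ∈ ball z d, (F w).re = u w := fun w hw => hFu hw
  have hFD : DifferentiableOn ℂ F (ball z d) := hF.differentiableOn
  obtain ⟨h1, h2⟩ := aux_harnack hd hFD (fun w hw => by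
    rw [hFu' w hw]; exact hpos w (hsub hw))
  constructor
  · intro w hw
    have := h1 w hw
    rwa [hFu' w hw, hFu' z hz] at this
  · rw [hFu' z hz] at h2
    have hFd : HasDerivAt F (deriv F z) z :=
      (hFD.differentiableAt (isOpen_ball.mem_nhds hz)).hasDerivAt
    have h3 : HasFDerivAt (fun w => (F w).re) _ z :=
      reCLM.hasFDerivAt.comp z (hFd.hasFDerivAt.restrictScalars ℝ)
    have h4 := (h3.congr_of_eventuallyEq (f₁ := u) (by
      filter_upwards [isOpen_ball.mem_nhds hz] with w hw
      exact (hFu' w hw).symm)).fderiv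
    have h5 : grad2 u z = (starRingEnd ℂ) (deriv F z) := by
      unfold grad2
      rw [h4]
      apply Complex.ext <;> simp
    rw [h5, Complex.norm_conj]
    exact h2

lemma aux_lip {u : ℂ → ℝ} {s : Set ℂ} (hs : IsOpen s) (hc : Convex ℝ s)
    (hu : DifferentiableOn ℝ u s) {C : ℝ} (hb : ∀ w ∈ s, ‖grad2 u w‖ ≤ C) {x y : ℂ}
    (hx : x ∈ s) (hy : y ∈ s) : |u y - u x| ≤ C * ‖y - x‖ := by
  have := hc.norm_image_sub_le_of_norm_fderiv_le (𝕜 := ℝ) (f := u) (C := C)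
    (fun w hw => hu.differentiableAt (hs.mem_nhds hw))
    (fun w hw => (aux_fderiv_norm u w).trans (hb w hw)) hx hy
  simpa using this

lemma aux_main {R : ℝ} {u : ℂ → ℝ} (hu : IsClassicalSolution (ball 0 R) u)
    (h0 : (0 : ℂ) ∈ FB (ball 0 R) u) {z : ℂ} (hzR : z ∈ ball (0 : ℂ) (R / 2))
    (hz : z ∈ posSet (ball 0 R) u) :
    ∃ d : ℝ, 0 < d ∧ ball z d ⊆ posSet (ball 0 R) u ∧ u z ≤ 4 * d ∧ ‖grad2 u z‖ ≤ 8 := by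
  set P := posSet (ball 0 R) u with hP
  have hPo : IsOpen P := by
    have := hu.contOn.isOpen_inter_preimage isOpen_ball (isOpen_Ioi (a := (0 : ℝ)))
    exact this
  have hPpos : ∀ w ∈ P, 0 < u w := fun w hw => hw.2
  have h0P : (0 : ℂ) ∈ Pᶜ := by
    have := h0.2.2
    rwa [hPo.interior_eq] at this
  obtain ⟨x, hxP, hx⟩ := hPo.isClosed_compl.exists_infDist_eq_dist ⟨0, h0P⟩ z
  set d := dist z x with hd
  have hball : ball z d ⊆ P := by
    intro w hw
    by_contra hwP
    have := infDist_le_dist_of_mem (x := z) (show w ∈ Pᶜ from hwP)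
    rw [hx, dist_comm] at this
    exact absurd hw (not_lt.2 this)
  have hd0 : 0 < d := dist_pos.2 (fun h => hxP (h ▸ hz))
  have hdz : d ≤ dist z 0 := hx ▸ infDist_le_dist_of_mem h0P
  have hxR : x ∈ ball (0 : ℂ) R := by
    rw [mem_ball] at hzR ⊢
    have := dist_triangle x z 0
    rw [dist_comm x z] at this
    linarith
  have hux : u x = 0 := by
    have h1 := hu.nonneg x hxR
    by_contra hne
    exact hxP ⟨hxR, lt_of_le_of_ne h1 (Ne.symm hne)⟩
  have hxcl : x ∈ closure (ball z d) := by
    rw [closure_ball z hd0.ne', mem_closedBall, dist_comm]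
  have hxFB : x ∈ FB (ball 0 R) u :=
    ⟨hxR, closure_mono hball hxcl, by rw [← hP, hPo.interior_eq]; exact hxP⟩
  have hev : ∀ᶠ w in 𝓝[P] x, ‖grad2 u w‖ ≤ 2 :=
    ((hu.grad_one x hxFB).eventually (gt_mem_nhds (by norm_num : (1 : ℝ) < 2))).mono
      fun _ h => h.le
  obtain ⟨δ, hδ, hδs⟩ := Metric.mem_nhdsWithin_iff.1 hev
  set s := ball x δ ∩ ball z d with hs
  have hso : IsOpen s := isOpen_ball.inter isOpen_ball
  have hsc : Convex ℝ s := (convex_ball _ _).inter (convex_ball _ _)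
  have hsP : s ⊆ P := fun w hw => hball hw.2
  have hdiff : DifferentiableOn ℝ u P := hu.harm.1.differentiableOn (by norm_num)
  have hxs : x ∈ closure s := by
    rw [mem_closure_iff_nhds] at hxcl ⊢
    intro t ht
    obtain ⟨w, hw⟩ := hxcl (t ∩ ball x δ) (inter_mem ht (ball_mem_nhds x hδ))
    exact ⟨w, hw.1.1, hw.1.2, hw.2⟩
  have hlin : ∀ w ∈ s, u w ≤ 2 * ‖w - x‖ := by
    intro w hw
    have hne : (𝓝[s] x).NeBot := mem_closure_iff_nhdsWithin_neBot.1 hxs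
    have hcx : ContinuousAt u x := hu.contOn.continuousAt (isOpen_ball.mem_nhds hxR)
    have t1 : Tendsto (fun y => u w - u y) (𝓝[s] x) (𝓝 (u w - u x)) :=
      (tendsto_const_nhds.sub hcx.tendsto).mono_left nhdsWithin_le_nhds
    have t2 : Tendsto (fun y => 2 * ‖w - y‖) (𝓝[s] x) (𝓝 (2 * ‖w - x‖)) :=
      (Continuous.tendsto (by fun_prop) x).mono_left nhdsWithin_le_nhds
    have := le_of_tendsto_of_tendsto t1 t2 (by
      filter_upwards [self_mem_nhdsWithin] with y hy
      exact (le_abs_self _).trans (aux_lip hso hsc (hdiff.mono hsP)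
        (fun w hw => hδs ⟨hw.1, hsP hw⟩) hy hw))
    simpa [hux] using this
  obtain ⟨hH, hG⟩ := aux_pos hPo hu.harm hd0 hball hPpos
  have hu4 : u z ≤ 4 * d := by
    -- a point on the radius, close to x
    obtain ⟨τ, hτ0, hτ1, hτδ⟩ : ∃ τ : ℝ, 0 < τ ∧ τ < 1 ∧ τ * d < δ := by
      refine ⟨min (1 / 2) (δ / (2 * d)), by positivity,
        lt_of_le_of_lt (min_le_left _ _) (by norm_num), ?_⟩
      have : min (1 / 2) (δ / (2 * d)) * d ≤ δ / (2 * d) * d := by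
        gcongr; exact min_le_right _ _
      have e : δ / (2 * d) * d = δ / 2 := by field_simp
      linarith
    set w : ℂ := x + (τ : ℂ) * (z - x) with hw
    have hwx : ‖w - x‖ = τ * d := by
      rw [hw, hd, dist_eq_norm]; simp [abs_of_pos hτ0]
    have hwz : dist w z = (1 - τ) * d := by
      have : w - z = -(((1 - τ : ℝ) : ℂ) * (z - x)) := by rw [hw]; push_cast; ring
      rw [dist_eq_norm, this, norm_neg, norm_mul, Complex.norm_real, Real.norm_eq_abs,
        abs_of_pos (by linarith), hd, dist_eq_norm]
    have hwb : w ∈ ball z d := by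
      rw [mem_ball, hwz]; nlinarith
    have hws : w ∈ s := ⟨by rw [mem_ball, dist_eq_norm, hwx]; exact hτδ, hwb⟩
    have h1 := hH w hwb
    have h2 := hlin w hws
    have h3 : dist w z / d = 1 - τ := by rw [hwz]; field_simp
    rw [h3] at h1
    rw [hwx] at h2
    have hw0 := hPpos w (hsP hws)
    have h4 : u z * τ ≤ (4 * d) * τ := by nlinarith
    exact le_of_mul_le_mul_right h4 hτ0
  refine ⟨d, hd0, hball, hu4, hG.trans ?_⟩
  rw [div_le_iff₀ hd0]
  linarith

/-- universal Lipschitz bound for classical solutions in a disk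
with `0` on the free boundary. -/
theorem lipschitz_bound_classical_solution :
    ∃ C : ℝ≥0, 0 < C ∧ ∀ R : ℝ, 0 < R → ∀ u : ℂ → ℝ,
      IsClassicalSolution (Metric.ball 0 R) u →
      (0 : ℂ) ∈ FB (Metric.ball 0 R) u →
      (∀ z ∈ Metric.ball (0 : ℂ) (R / 2) ∩ posSet (Metric.ball 0 R) u,
        ‖grad2 u z‖ ≤ C) ∧
      LipschitzOnWith C u (Metric.ball 0 (R / 2)) := by
  refine ⟨8, by norm_num, fun R hR u hu h0 => ⟨?_, ?_⟩⟩
  · rintro z ⟨hz, hzP⟩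
    obtain ⟨d, -, -, -, h⟩ := aux_main hu h0 hz hzP
    simpa using h
  · have key : ∀ x ∈ ball (0 : ℂ) (R / 2), ∀ y ∈ ball (0 : ℂ) (R / 2),
        u x - u y ≤ 8 * ‖x - y‖ := by
      intro x hx y hy
      have hsub : ball (0 : ℂ) (R / 2) ⊆ ball 0 R := ball_subset_ball (by linarith)
      have huy := hu.nonneg y (hsub hy)
      have hn := norm_nonneg (x - y)
      by_cases hxP : x ∈ posSet (ball 0 R) u
      · obtain ⟨d, hd, hb, h4, -⟩ := aux_main hu h0 hx hxP
        by_cases hxy : y ∈ ball x d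
        · refine (le_abs_self _).trans (aux_lip (s := ball x d ∩ ball 0 (R / 2))
            (isOpen_ball.inter isOpen_ball) ((convex_ball _ _).inter (convex_ball _ _))
            ((hu.harm.1.differentiableOn (by norm_num)).mono fun w hw => hb hw.1) ?_ ⟨hxy, hy⟩
            ⟨mem_ball_self hd, hx⟩)
          intro w hw
          obtain ⟨_, -, -, -, h⟩ := aux_main hu h0 hw.2 (hb hw.1)
          exact h
        · rw [mem_ball, dist_comm, dist_eq_norm, not_lt] at hxy
          linarith
      · have : ¬ 0 < u x := fun h => hxP ⟨hsub hx, h⟩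
        linarith
    refine LipschitzOnWith.of_dist_le_mul fun x hx y hy => ?_
    rw [Real.dist_eq, dist_eq_norm, abs_le]
    have h1 := key x hx y hy
    have h2 := key y hy x hx
    rw [norm_sub_rev] at h2
    simp only [NNReal.coe_ofNat]
    constructor <;> linarith
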